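/- Connection formula for the ₁ψ₁ Jackson integral: let 0<q<1 and let α, β be real numbers with 0 < α and α + β < 1, β ∉ ℤ, α + β ∉ ℤ, and let ξ > 0 satisfy log_q ξ + β ∉ ℤ. Define I(ξ) := (1-q) ∑_{ν∈ℤ} (ξ q^ν)^α (q·ξq^ν)_∞ / (q^β·ξq^ν)_∞. Then I(ξ) = ξ^α · ( θ(q^{α+β}ξ) θ(q^{β}) / ( θ(q^{α+β}) θ(q^{β}ξ) ) ) · I(1). -/

import Mathlib

/-- The infinite q-shifted factorial `(u)_∞ = ∏_{l=0}^∞ (1 - u q^l)`. -/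
noncomputable def qPoch (q u : ℝ) : ℝ := ∏' l : ℕ, (1 - u * q ^ l)

/-- The theta function `θ(z) = (z)_∞ (q/z)_∞ (q)_∞`. -/
noncomputable def qTheta (q z : ℝ) : ℝ := qPoch q z * qPoch q (q / z) * qPoch q q

/-- The bilateral Jackson integral `I(ξ) = ∫_0^{ξ∞} z^α (qz)_∞/(q^β z)_∞ d_q z / z`. -/
noncomputable def ramanujanI (q α β ξ : ℝ) : ℝ :=
  (1 - q) * ∑' ν : ℤ, (ξ * q ^ ν) ^ α * qPoch q (q * (ξ * q ^ ν)) / qPoch q (q ^ β * (ξ * q ^ ν))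

open Filter Topology

section QPochhammer

variable {q : ℝ}

theorem summable_norm_neg_mul_pow (hq0 : 0 < q) (hq1 : q < 1) (u : ℝ) :
    Summable fun l : ℕ => ‖-(u * q ^ l)‖ := by
  simpa [abs_mul, abs_of_pos hq0] using
    (summable_geometric_of_lt_one hq0.le hq1).mul_left |u|

theorem multipliable_one_sub_mul_pow (hq0 : 0 < q) (hq1 : q < 1) (u : ℝ) :
    Multipliable fun l : ℕ => 1 - u * q ^ l := by
  simpa [sub_eq_add_neg] using
    multipliable_one_add_of_summable (summable_norm_neg_mul_pow hq0 hq1 u)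

theorem tendsto_prod_qPoch (hq0 : 0 < q) (hq1 : q < 1) (u : ℝ) :
    Tendsto (fun N => ∏ l ∈ Finset.range N, (1 - u * q ^ l)) atTop (𝓝 (qPoch q u)) :=
  (multipliable_one_sub_mul_pow hq0 hq1 u).hasProd.tendsto_prod_nat

theorem qPoch_eq_mul (hq0 : 0 < q) (hq1 : q < 1) (u : ℝ) :
    qPoch q u = (1 - u) * qPoch q (u * q) := by
  have h : Multipliable fun l : ℕ => 1 - u * q ^ (l + 1) := by
    simpa [pow_succ', mul_assoc] using multipliable_one_sub_mul_pow hq0 hq1 (u * q)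
  have e := tprod_eq_zero_mul' (f := fun l : ℕ => 1 - u * q ^ l) h
  simp only [pow_zero, mul_one, pow_succ', ← mul_assoc] at e
  exact e

theorem qPoch_ne_zero (hq0 : 0 < q) (hq1 : q < 1) {u : ℝ} (hu : ∀ l : ℕ, u * q ^ l ≠ 1) :
    qPoch q u ≠ 0 := by
  have := tprod_one_add_ne_zero_of_summable (f := fun l : ℕ => -(u * q ^ l))
    (fun l h => hu l (by linarith)) (summable_norm_neg_mul_pow hq0 hq1 u)
  simpa [qPoch, sub_eq_add_neg] using this

theorem qPoch_eq_zero {u : ℝ} {l : ℕ} (hu : u * q ^ l = 1) : qPoch q u = 0 :=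
  tprod_of_exists_eq_zero ⟨l, by simp [hu]⟩

@[simp]
theorem qPoch_zero : qPoch q 0 = 1 := by simp [qPoch]

theorem continuous_qPoch (hq0 : 0 < q) (hq1 : q < 1) : Continuous (qPoch q) := by
  refine continuous_iff_continuousAt.2 fun u => ?_
  have h := tendsto_tprod_one_add_of_dominated_convergence (𝓕 := 𝓝 u)
    (f := fun v (l : ℕ) => -(v * q ^ l)) (g := fun l : ℕ => -(u * q ^ l))
    (bound := fun l : ℕ => (|u| + 1) * q ^ l)
    ((summable_geometric_of_lt_one hq0.le hq1).mul_left _)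
    (fun l => Continuous.tendsto (by fun_prop) u) ?_
  · have e : qPoch q = fun v => ∏' l : ℕ, (1 + -(v * q ^ l)) := by
      funext v
      simp only [qPoch, sub_eq_add_neg]
    rw [e]
    exact h
  · have : ∀ᶠ v in 𝓝 u, |v| < |u| + 1 :=
      continuous_abs.continuousAt.eventually_lt continuousAt_const (by simp)
    filter_upwards [this] with v hv l
    rw [norm_neg, norm_mul, norm_pow, Real.norm_eq_abs, Real.norm_eq_abs, abs_of_pos hq0]
    gcongr

theorem abs_qPoch_le (hq0 : 0 < q) (hq1 : q < 1) {u v : ℝ} (huv : |u| ≤ v) :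
    |qPoch q u| ≤ qPoch q (-v) := by
  refine le_of_tendsto_of_tendsto' (tendsto_prod_qPoch hq0 hq1 u).abs
    (tendsto_prod_qPoch hq0 hq1 (-v)) fun N => ?_
  rw [Finset.abs_prod]
  refine Finset.prod_le_prod (fun _ _ => abs_nonneg _) fun l _ => ?_
  calc |1 - u * q ^ l| ≤ |1| + |u * q ^ l| := abs_sub _ _
    _ = 1 + |u| * q ^ l := by rw [abs_one, abs_mul, abs_of_pos (pow_pos hq0 l)]
    _ ≤ 1 - -v * q ^ l := by
      rw [neg_mul, sub_neg_eq_add]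
      gcongr

theorem tendsto_qPoch_mul_pow (hq0 : 0 < q) (hq1 : q < 1) (u : ℝ) :
    Tendsto (fun n : ℕ => qPoch q (u * q ^ n)) atTop (𝓝 1) := by
  have h : Tendsto (fun n : ℕ => u * q ^ n) atTop (𝓝 0) := by
    simpa using (tendsto_pow_atTop_nhds_zero_of_lt_one hq0.le hq1).const_mul u
  simpa [Function.comp_def] using ((continuous_qPoch hq0 hq1).tendsto 0).comp h

/-- Iterating a first order `q`-difference equation towards the limit of its solution. -/
theorem qPoch_mul_eq_of_recurrence (hq0 : 0 < q) (hq1 : q < 1) {c d L : ℝ} {f : ℕ → ℝ}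
    (hf : ∀ N, (1 - c * q ^ N) * f N = (1 - d * q ^ N) * f (N + 1))
    (hL : Tendsto f atTop (𝓝 L)) : qPoch q c * f 0 = qPoch q d * L := by
  have h : ∀ N, (∏ l ∈ Finset.range N, (1 - c * q ^ l)) * f 0 =
      (∏ l ∈ Finset.range N, (1 - d * q ^ l)) * f N := by
    intro N
    induction N with
    | zero => simp
    | succ N ih =>
      rw [Finset.prod_range_succ, Finset.prod_range_succ, mul_right_comm, ih, mul_right_comm,
        mul_assoc _ (1 - d * q ^ N), ← hf N]
      ring
  refine tendsto_nhds_unique ((tendsto_prod_qPoch hq0 hq1 c).mul_const (f 0)) ?_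
  simp_rw [h]
  exact (tendsto_prod_qPoch hq0 hq1 d).mul hL

end QPochhammer

/-- The general term of the bilateral series `∑ xⁿ (b qⁿ)_∞ / (a qⁿ)_∞`. -/
noncomputable def psiTerm (q x a b : ℝ) (n : ℤ) : ℝ :=
  x ^ n * qPoch q (b * q ^ n) / qPoch q (a * q ^ n)

/-- The bilateral series `∑ xⁿ (b qⁿ)_∞ / (a qⁿ)_∞`, a normalization of `₁ψ₁`. -/
noncomputable def psiSum (q x a b : ℝ) : ℝ := ∑' n : ℤ, psiTerm q x a b n

section Bilateral

variable {q x a b : ℝ}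

theorem qPoch_mul_zpow_ne_zero (hq0 : 0 < q) (hq1 : q < 1) (ha : ∀ n : ℤ, a * q ^ n ≠ 1)
    (n : ℤ) : qPoch q (a * q ^ n) ≠ 0 := by
  refine qPoch_ne_zero hq0 hq1 fun l => ?_
  have := ha (n + l)
  rwa [zpow_add₀ hq0.ne', zpow_natCast, ← mul_assoc] at this

theorem psiTerm_sub_one (hq0 : 0 < q) (hq1 : q < 1) (hx0 : 0 < x)
    (n : ℤ) : psiTerm q x a b (n - 1) =
      x⁻¹ * ((1 - b * q ^ (n - 1)) / (1 - a * q ^ (n - 1))) * psiTerm q x a b n := by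
  have h (u : ℝ) : qPoch q (u * q ^ (n - 1)) = (1 - u * q ^ (n - 1)) * qPoch q (u * q ^ n) := by
    rw [qPoch_eq_mul hq0 hq1, mul_assoc u, ← zpow_add_one₀ hq0.ne', sub_add_cancel]
  rw [psiTerm, psiTerm, h, h, zpow_sub_one₀ hx0.ne', mul_assoc x⁻¹, div_mul_div_comm]
  ring

theorem summable_psiTerm_nat (hq0 : 0 < q) (hq1 : q < 1) (hx0 : 0 < x) (hx1 : x < 1)
    (a b : ℝ) : Summable fun n : ℕ => psiTerm q x a b n := by
  have h := (tendsto_qPoch_mul_pow hq0 hq1 b).div (tendsto_qPoch_mul_pow hq0 hq1 a) one_ne_zero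
  obtain ⟨C, hC⟩ := (Metric.isBounded_range_of_tendsto _ h).exists_norm_le
  refine .of_norm_bounded (g := fun n => C * x ^ n)
    ((summable_geometric_of_lt_one hx0.le hx1).mul_left C) fun n => ?_
  have := hC _ ⟨n, rfl⟩
  simp only [psiTerm, zpow_natCast, mul_div_assoc, norm_mul, norm_pow, Real.norm_of_nonneg hx0.le]
  rw [mul_comm]
  exact mul_le_mul_of_nonneg_right this (by positivity)

theorem summable_psiTerm (hq0 : 0 < q) (hq1 : q < 1) (hx0 : 0 < x) (hx1 : x < 1)
    (ha0 : 0 < a) (hb : |b| < a * x) : Summable (psiTerm q x a b) := by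
  refine .of_nat_of_neg_add_one (summable_psiTerm_nat hq0 hq1 hx0 hx1 a b) ?_
  have hp : Tendsto (fun n : ℕ => q ^ (n + 2)) atTop (𝓝 0) :=
    (tendsto_pow_atTop_nhds_zero_of_lt_one hq0.le hq1).comp (tendsto_add_atTop_nat 2)
  have hlim : Tendsto (fun n : ℕ => |x⁻¹ * ((q ^ (n + 2) - b) / (q ^ (n + 2) - a))|) atTop
      (𝓝 |x⁻¹ * ((0 - b) / (0 - a))|) :=
    (((hp.sub_const b).div (hp.sub_const a) (by simpa using ha0.ne')).const_mul x⁻¹).abs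
  have hlt : |x⁻¹ * ((0 - b) / (0 - a))| < 1 := by
    rw [zero_sub, zero_sub, neg_div_neg_eq, abs_mul, abs_div, abs_inv, abs_of_pos hx0,
      abs_of_pos ha0, inv_mul_eq_div, div_div, div_lt_one (by positivity)]
    exact hb
  obtain ⟨r, hr, hr1⟩ := exists_between hlt
  refine summable_of_ratio_norm_eventually_le hr1 ?_
  filter_upwards [hlim.eventually (eventually_lt_nhds hr)] with n hn
  have hidx : (-((n + 1 : ℕ) + 1) : ℤ) = -(n + 1) - 1 := by push_cast; ring
  have hpow : q ^ (-((n : ℤ) + 1) - 1) = (q ^ (n + 2))⁻¹ := by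
    rw [← zpow_natCast, ← zpow_neg]
    exact congrArg (q ^ ·) (by push_cast; ring)
  have hqn : q ^ (n + 2) ≠ 0 := (pow_pos hq0 _).ne'
  have hs (u : ℝ) : 1 - u * (q ^ (n + 2))⁻¹ = (q ^ (n + 2) - u) / q ^ (n + 2) := by
    field_simp
  rw [hidx, psiTerm_sub_one hq0 hq1 hx0, hpow, hs, hs, div_div_div_cancel_right₀ hqn, norm_mul]
  gcongr
  exact hn.le

theorem qPoch_zpow_eq_zero (hq0 : 0 < q) {k : ℤ} (hk : k ≤ 0) : qPoch q (q ^ k) = 0 := by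
  refine qPoch_eq_zero (l := k.natAbs) ?_
  rw [← zpow_natCast, ← zpow_add₀ hq0.ne', show k + (k.natAbs : ℤ) = 0 by omega, zpow_zero]

theorem psiTerm_pow_eq_zero (hq0 : 0 < q) {m : ℕ} {n : ℤ} (h : m + n ≤ 0) :
    psiTerm q x a (q ^ m) n = 0 := by
  rw [psiTerm, ← zpow_natCast q m, ← zpow_add₀ hq0.ne', qPoch_zpow_eq_zero hq0 h]
  simp

theorem summable_psiTerm_pow (hq0 : 0 < q) (hq1 : q < 1) (hx0 : 0 < x) (hx1 : x < 1) (a : ℝ)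
    (m : ℕ) : Summable (psiTerm q x a (q ^ m)) := by
  refine .of_nat_of_neg_add_one (summable_psiTerm_nat hq0 hq1 hx0 hx1 a _) ?_
  refine summable_of_ne_finset_zero (s := Finset.range m) fun n hn => ?_
  exact psiTerm_pow_eq_zero hq0 (by rw [Finset.mem_range] at hn; omega)

theorem psiTerm_shift (hq0 : 0 < q) (hx0 : 0 < x) (n : ℤ) :
    psiTerm q x a b (n + 1) = x * psiTerm q x (a * q) (b * q) n := by
  simp only [psiTerm, zpow_add_one₀ hq0.ne', zpow_add_one₀ hx0.ne']
  rw [mul_comm (q ^ n) q, ← mul_assoc, ← mul_assoc]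
  ring

theorem psiSum_shift (hq0 : 0 < q) (hx0 : 0 < x) :
    psiSum q x a b = x * psiSum q x (a * q) (b * q) := by
  rw [psiSum, psiSum, ← (Equiv.addRight (1 : ℤ)).tsum_eq, ← tsum_mul_left]
  exact tsum_congr fun n => psiTerm_shift hq0 hx0 n

/-- Contiguous relation in the numerator parameter. -/
theorem psiSum_contiguous (hq0 : 0 < q) (hq1 : q < 1) (hx0 : 0 < x)
    (ha : ∀ n : ℤ, a * q ^ n ≠ 1) (h₀ : Summable (psiTerm q x a b)) :
    (a * x - b) * psiSum q x a b = x * (a - b) * psiSum q x a (b * q) := by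
  have h₂ : Summable fun n : ℤ => psiTerm q x a b (n + 1) :=
    (Equiv.addRight (1 : ℤ)).summable_iff.2 h₀
  have hs : ∑' n : ℤ, psiTerm q x a b (n + 1) = psiSum q x a b :=
    (Equiv.addRight (1 : ℤ)).tsum_eq _
  have key (n : ℤ) : a * x * psiTerm q x a b n - b * psiTerm q x a b (n + 1) =
      x * (a - b) * psiTerm q x a (b * q) n := by
    have hA : 1 - a * q ^ n ≠ 0 := sub_ne_zero.2 (ha n).symm
    have hP := qPoch_mul_zpow_ne_zero hq0 hq1 ha n
    have hPa := qPoch_eq_mul hq0 hq1 (a * q ^ n)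
    have hPb := qPoch_eq_mul hq0 hq1 (b * q ^ n)
    have e (u : ℝ) : u * q ^ (n + 1) = u * q ^ n * q := by rw [zpow_add_one₀ hq0.ne']; ring
    have hQ : qPoch q (a * q ^ n * q) ≠ 0 := fun h => hP (by rw [hPa, h, mul_zero])
    simp only [psiTerm, e, zpow_add_one₀ hx0.ne', mul_right_comm b q (q ^ n)]
    rw [hPa, hPb]
    field_simp
    ring
  calc (a * x - b) * psiSum q x a b
      = ∑' n : ℤ, (a * x * psiTerm q x a b n - b * psiTerm q x a b (n + 1)) := by
        rw [(h₀.mul_left _).tsum_sub (h₂.mul_left _), tsum_mul_left, tsum_mul_left, hs, ← psiSum]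
        ring
    _ = x * (a - b) * psiSum q x a (b * q) := by
        simp_rw [key]
        rw [tsum_mul_left, psiSum]

theorem tendsto_psiSum_nhds_zero (hq0 : 0 < q) (hq1 : q < 1) (hx0 : 0 < x) (hx1 : x < 1)
    (ha0 : 0 < a) : Tendsto (psiSum q x a) (𝓝 0) (𝓝 (psiSum q x a 0)) := by
  have hax : 0 < a * x := mul_pos ha0 hx0
  refine tendsto_tsum_of_dominated_convergence
    (bound := fun n => ‖psiTerm q x a (-(a * x / 2)) n‖)
    (summable_psiTerm hq0 hq1 hx0 hx1 ha0 ?_).norm (fun n => ?_) ?_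
  · rw [abs_neg, abs_of_pos (by positivity)]
    linarith
  · have : Continuous fun b => psiTerm q x a b n :=
      (((continuous_qPoch hq0 hq1).comp (continuous_id.mul continuous_const)).const_mul
        (x ^ n)).div_const _
    exact this.tendsto 0
  · have : ∀ᶠ b : ℝ in 𝓝 0, |b| < a * x / 2 :=
      continuous_abs.continuousAt.eventually_lt continuousAt_const (by simpa using hax)
    filter_upwards [this] with b hb n
    simp only [psiTerm, norm_div, norm_mul]
    gcongr
    refine (abs_qPoch_le hq0 hq1 (v := a * x / 2 * q ^ n) ?_).trans ?_
    · rw [abs_mul, abs_of_pos (zpow_pos hq0 n)]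
      gcongr
    · rw [← neg_mul]
      exact le_abs_self _

theorem tendsto_mul_pow_zero (hq0 : 0 < q) (hq1 : q < 1) (u : ℝ) :
    Tendsto (fun N : ℕ => u * q ^ N) atTop (𝓝 0) := by
  simpa using (tendsto_pow_atTop_nhds_zero_of_lt_one hq0.le hq1).const_mul u

theorem psiSum_eq_psiSum_zero (hq0 : 0 < q) (hq1 : q < 1) (hx0 : 0 < x) (hx1 : x < 1)
    (ha0 : 0 < a) (ha : ∀ n : ℤ, a * q ^ n ≠ 1)
    (hb : ∀ N : ℕ, Summable (psiTerm q x a (b * q ^ N))) :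
    qPoch q (b / (a * x)) * psiSum q x a b = qPoch q (b / a) * psiSum q x a 0 := by
  have h := qPoch_mul_eq_of_recurrence hq0 hq1 (c := b / (a * x)) (d := b / a)
    (f := fun N => psiSum q x a (b * q ^ N)) (fun N => ?_)
    ((tendsto_psiSum_nhds_zero hq0 hq1 hx0 hx1 ha0).comp (tendsto_mul_pow_zero hq0 hq1 b))
  · simpa using h
  · have e : b * q ^ (N + 1) = b * q ^ N * q := by ring
    have h := psiSum_contiguous hq0 hq1 hx0 ha (hb N)
    simp only [e]
    field_simp
    linear_combination h

theorem tendsto_psiSum_left (hq0 : 0 < q) (hq1 : q < 1) (hx0 : 0 < x) (hx1 : x < 1) (a : ℝ) :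
    Tendsto (fun N : ℕ => psiSum q x (a * q ^ N) q) atTop (𝓝 (psiSum q x 0 q)) := by
  have hinv : Tendsto (fun n : ℕ => (qPoch q (a * q ^ n))⁻¹) atTop (𝓝 1⁻¹) :=
    (tendsto_qPoch_mul_pow hq0 hq1 a).inv₀ one_ne_zero
  obtain ⟨C, hC⟩ := (Metric.isBounded_range_of_tendsto _ hinv).exists_norm_le
  refine tendsto_tsum_of_dominated_convergence
    (bound := fun n => C * ‖psiTerm q x 0 q n‖) ?_ (fun n => ?_) (.of_forall fun N n => ?_)
  · simpa using (summable_psiTerm_pow hq0 hq1 hx0 hx1 0 1).norm.mul_left C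
  · have h₁ : Tendsto (fun N : ℕ => a * q ^ N * q ^ n) atTop (𝓝 0) := by
      simpa using (tendsto_mul_pow_zero hq0 hq1 a).mul_const (q ^ n)
    have h₂ := ((continuous_qPoch hq0 hq1).tendsto 0).comp h₁
    rw [psiTerm, zero_mul]
    exact tendsto_const_nhds.div h₂ (by simp)
  · rcases lt_or_ge n 0 with hn | hn
    · have (u : ℝ) : psiTerm q x u q n = 0 := by
        simpa using psiTerm_pow_eq_zero (x := x) (a := u) hq0 (m := 1) (n := n) (by push_cast; omega)
      simp [this]
    · lift n to ℕ using hn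
      have := hC _ ⟨N + n, rfl⟩
      simp only [psiTerm, zpow_natCast, zero_mul, qPoch_zero, div_one, mul_assoc a, ← pow_add]
      rw [div_eq_inv_mul, norm_mul]
      gcongr

/-- The `q`-binomial theorem, up to a factor independent of `a`. -/
theorem qPoch_mul_psiSum (hq0 : 0 < q) (hq1 : q < 1) (hx0 : 0 < x) (hx1 : x < 1)
    (ha : ∀ n : ℤ, a * q ^ n ≠ 1) :
    qPoch q a * psiSum q x a q = qPoch q (a * x) * psiSum q x 0 q := by
  have h := qPoch_mul_eq_of_recurrence hq0 hq1 (c := a) (d := a * x)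
    (f := fun N => psiSum q x (a * q ^ N) q) (fun N => ?_)
    (tendsto_psiSum_left hq0 hq1 hx0 hx1 a)
  · simpa using h
  · have hN (n : ℤ) : a * q ^ N * q ^ n ≠ 1 := by
      rw [mul_assoc, ← zpow_natCast, ← zpow_add₀ hq0.ne']
      exact ha _
    have h := psiSum_contiguous (b := 1) hq0 hq1 hx0 hN
      (by simpa using summable_psiTerm_pow hq0 hq1 hx0 hx1 (a * q ^ N) 0)
    rw [psiSum_shift hq0 hx0, one_mul] at h
    have e : a * q ^ (N + 1) = a * q ^ N * q := by ring
    simp only [e]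
    refine mul_left_cancel₀ hx0.ne' ?_
    linear_combination h

theorem qTheta_mul_psiSum_zero (hq0 : 0 < q) (hq1 : q < 1) (hx0 : 0 < x) (hx1 : x < 1)
    (ha0 : 0 < a) (ha : ∀ n : ℤ, a * q ^ n ≠ 1) :
    qTheta q a * psiSum q x a 0 = qTheta q (a * x) * psiSum q x 0 q := by
  have h₁ := psiSum_eq_psiSum_zero (b := q) hq0 hq1 hx0 hx1 ha0 ha fun N => by
    rw [← pow_succ']
    exact summable_psiTerm_pow hq0 hq1 hx0 hx1 a (N + 1)
  have h₂ := qPoch_mul_psiSum hq0 hq1 hx0 hx1 ha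
  unfold qTheta
  linear_combination -qPoch q a * qPoch q q * h₁ + qPoch q (q / (a * x)) * qPoch q q * h₂

end Bilateral

section Powers

variable {q s : ℝ}

theorem rpow_mul_zpow_ne_one (hq0 : 0 < q) (hq1 : q < 1) (hs : ∀ m : ℤ, s ≠ m) (n : ℤ) :
    q ^ s * q ^ n ≠ 1 := by
  rw [← Real.rpow_intCast, ← Real.rpow_add hq0, Ne]
  intro h
  have h₀ : s + n = 0 := by
    have := Real.logb_rpow (x := s + n) hq0 hq1.ne
    rwa [h, Real.logb_one, eq_comm] at this
  exact hs (-n) (by push_cast; linarith)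

theorem qPoch_rpow_ne_zero (hq0 : 0 < q) (hq1 : q < 1) (hs : ∀ m : ℤ, s ≠ m) :
    qPoch q (q ^ s) ≠ 0 := by
  simpa using qPoch_mul_zpow_ne_zero hq0 hq1 (rpow_mul_zpow_ne_one hq0 hq1 hs) 0

theorem qTheta_rpow_ne_zero (hq0 : 0 < q) (hq1 : q < 1) (hs : ∀ m : ℤ, s ≠ m) :
    qTheta q (q ^ s) ≠ 0 := by
  refine mul_ne_zero (mul_ne_zero (qPoch_rpow_ne_zero hq0 hq1 hs) ?_) ?_
  · have e : q / q ^ s = q ^ (1 - s) := by rw [Real.rpow_sub hq0, Real.rpow_one]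
    rw [e]
    refine qPoch_rpow_ne_zero hq0 hq1 fun m h => hs (1 - m) ?_
    push_cast
    linarith
  · refine qPoch_ne_zero hq0 hq1 fun l => ?_
    rw [← pow_succ']
    exact (pow_lt_one₀ hq0.le hq1 l.succ_ne_zero).ne

theorem ramanujanI_eq_psiSum (hq0 : 0 < q) {α β ξ : ℝ} (hξ : 0 < ξ) :
    ramanujanI q α β ξ = (1 - q) * (ξ ^ α * psiSum q (q ^ α) (q ^ β * ξ) (q * ξ)) := by
  rw [ramanujanI, psiSum, ← tsum_mul_left (a := ξ ^ α)]
  refine congrArg ((1 - q) * ·) (tsum_congr fun n => ?_)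
  have e : (ξ * q ^ n) ^ α = ξ ^ α * (q ^ α) ^ n := by
    rw [Real.mul_rpow hξ.le (zpow_pos hq0 n).le, ← Real.rpow_intCast, ← Real.rpow_intCast,
      ← Real.rpow_mul hq0.le, ← Real.rpow_mul hq0.le, mul_comm α]
  rw [psiTerm, e, ← mul_assoc q, ← mul_assoc (q ^ β)]
  ring

end Powers

/-- The summation underlying the `₁ψ₁` formula, up to a factor independent of `ξ`. -/
theorem qPoch_mul_qTheta_mul_psiSum {q α β ξ : ℝ} (hq0 : 0 < q) (hq1 : q < 1) (hα : 0 < α)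
    (hαβ : α + β < 1) (hξ : 0 < ξ) (hne : ∀ n : ℤ, q ^ β * ξ * q ^ n ≠ 1) :
    qPoch q (q ^ (1 - (α + β))) *
        (qTheta q (q ^ β * ξ) * psiSum q (q ^ α) (q ^ β * ξ) (q * ξ)) =
      qPoch q (q ^ (1 - β)) *
        (qTheta q (q ^ (α + β) * ξ) * psiSum q (q ^ α) 0 q) := by
  have hx0 : 0 < q ^ α := Real.rpow_pos_of_pos hq0 α
  have hx1 : q ^ α < 1 := Real.rpow_lt_one hq0.le hq1 hα
  have hB : 0 < q ^ β := Real.rpow_pos_of_pos hq0 β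
  have ha0 : 0 < q ^ β * ξ := mul_pos hB hξ
  have hax : q ^ β * ξ * q ^ α = q ^ (α + β) * ξ := by rw [Real.rpow_add hq0]; ring
  have hlt : q < q ^ (α + β) := by
    simpa using Real.rpow_lt_rpow_of_exponent_gt hq0 hq1 hαβ
  have h₁ := psiSum_eq_psiSum_zero (b := q * ξ) hq0 hq1 hx0 hx1 ha0 hne fun N => by
    refine summable_psiTerm hq0 hq1 hx0 hx1 ha0 ?_
    rw [abs_of_pos (by positivity), hax]
    calc q * ξ * q ^ N ≤ q * ξ * 1 := by
          gcongr
          exact pow_le_one₀ hq0.le hq1.le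
      _ < q ^ (α + β) * ξ := by
          rw [mul_one]
          gcongr
  have h₂ := qTheta_mul_psiSum_zero hq0 hq1 hx0 hx1 ha0 hne
  rw [hax] at h₁ h₂
  rw [mul_div_mul_right _ _ hξ.ne', mul_div_mul_right _ _ hξ.ne'] at h₁
  rw [Real.rpow_sub hq0, Real.rpow_sub hq0, Real.rpow_one]
  linear_combination qTheta q (q ^ β * ξ) * h₁ + qPoch q (q / q ^ β) * h₂

/-- Connection formula for the `₁ψ₁` Jackson integral. -/
theorem one_psi_one_connection_formula (q α β ξ : ℝ) (hq0 : 0 < q) (hq1 : q < 1)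
    (hα : 0 < α) (hαβ : α + β < 1)
    (hβint : ∀ m : ℤ, β ≠ m) (hαβint : ∀ m : ℤ, α + β ≠ m)
    (hξ : 0 < ξ) (hgen : ∀ m : ℤ, Real.logb q ξ + β ≠ m) :
    ramanujanI q α β ξ =
      ξ ^ α * (qTheta q (q ^ (α + β) * ξ) * qTheta q (q ^ β) /
        (qTheta q (q ^ (α + β)) * qTheta q (q ^ β * ξ))) * ramanujanI q α β 1 := by
  have hA : q ^ β * ξ = q ^ (Real.logb q ξ + β) := by
    rw [Real.rpow_add hq0, Real.rpow_logb hq0 hq1.ne hξ, mul_comm]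
  have hξne (n : ℤ) : q ^ β * ξ * q ^ n ≠ 1 := hA ▸ rpow_mul_zpow_ne_one hq0 hq1 hgen n
  have hθξ : qTheta q (q ^ β * ξ) ≠ 0 := hA ▸ qTheta_rpow_ne_zero hq0 hq1 hgen
  have hθβ : qTheta q (q ^ β) ≠ 0 := qTheta_rpow_ne_zero hq0 hq1 hβint
  have hθαβ : qTheta q (q ^ (α + β)) ≠ 0 := qTheta_rpow_ne_zero hq0 hq1 hαβint
  have hc : qPoch q (q ^ (1 - (α + β))) ≠ 0 := by
    refine qPoch_rpow_ne_zero hq0 hq1 fun m h => hαβint (1 - m) ?_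
    push_cast
    linarith
  have h₁ := qPoch_mul_qTheta_mul_psiSum hq0 hq1 hα hαβ hξ hξne
  have h₂ := qPoch_mul_qTheta_mul_psiSum hq0 hq1 hα hαβ one_pos
    (by simpa using rpow_mul_zpow_ne_one hq0 hq1 hβint)
  rw [ramanujanI_eq_psiSum hq0 hξ, ramanujanI_eq_psiSum hq0 one_pos, Real.one_rpow, one_mul]
  simp only [mul_one] at h₂ ⊢
  have h : qTheta q (q ^ (α + β)) * (qTheta q (q ^ β * ξ) *
        psiSum q (q ^ α) (q ^ β * ξ) (q * ξ)) =
      qTheta q (q ^ (α + β) * ξ) * (qTheta q (q ^ β) * psiSum q (q ^ α) (q ^ β) q) := by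
    refine mul_left_cancel₀ hc ?_
    linear_combination qTheta q (q ^ (α + β)) * h₁ - qTheta q (q ^ (α + β) * ξ) * h₂
  rw [mul_div_assoc', div_mul_eq_mul_div, eq_div_iff (mul_ne_zero hθαβ hθξ)]
  linear_combination (1 - q) * ξ ^ α * h
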